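/- Let (V, ω) be a nonzero symplectic vector space. There is no linear map c : V ⊕ V → V ⊕ V preserving ω ⊕ ω such that c(x, 0) = (x, x) for all x ∈ V. -/

import Mathlib

/-- Traditional classical no-cloning theorem (linear setting): for a nonzero symplectic
vector space `(V, ω)`, there is no linear map `c : V ⊕ V → V ⊕ V` preserving `ω ⊕ ω`
such that `c (x, 0) = (x, x)` for all `x ∈ V`. -/
theorem no_linear_cloning
    {V : Type*} [AddCommGroup V] [Module ℝ V] [FiniteDimensional ℝ V]
    (ω : V →ₗ[ℝ] V →ₗ[ℝ] ℝ)
    (halt : ∀ v : V, ω v v = 0)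
    (hnd : ∀ v : V, (∀ w : V, ω v w = 0) → v = 0)
    (hdim : 0 < Module.finrank ℝ V) :
    ¬ ∃ c : (V × V) →ₗ[ℝ] (V × V),
      (∀ u w : V × V,
        ω (c u).1 (c w).1 + ω (c u).2 (c w).2 = ω u.1 w.1 + ω u.2 w.2) ∧
      (∀ x : V, c (x, 0) = (x, x)) := by
  rintro ⟨c, hc, hclone⟩
  have hω (v w : V) : ω v w = 0 := by
    have h := hc (v, 0) (w, 0)
    simp only [hclone, map_zero, add_zero] at h
    linarith
  have := Module.finrank_pos_iff.mp hdim
  obtain ⟨v, hv⟩ := exists_ne (0 : V)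
  exact hv (hnd v (hω v))
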